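/- For every 2-edge-connected graph G of order n, the Wiener index W(G) is at most W(C_n), with equality if and only if G is isomorphic to the cycle C_n. -/

import Mathlib

open SimpleGraph Finset

/-- Wiener index: sum of distances over unordered pairs of vertices. -/
noncomputable def wienerIndex {n : ℕ} (G : SimpleGraph (Fin n)) : ℕ :=
  ∑ p ∈ Finset.univ.filter (fun p : Fin n × Fin n => p.1 < p.2), G.dist p.1 p.2

/-- Harary index: sum of reciprocal distances over unordered pairs of vertices. -/
noncomputable def hararyIndex {n : ℕ} (G : SimpleGraph (Fin n)) : ℝ :=
  ∑ p ∈ Finset.univ.filter (fun p : Fin n × Fin n => p.1 < p.2), (1 : ℝ) / (G.dist p.1 p.2)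

/-- A graph is Eulerian if it is connected and every vertex has even degree. -/
def IsEulerian {n : ℕ} (G : SimpleGraph (Fin n)) [DecidableRel G.Adj] : Prop :=
  G.Connected ∧ ∀ v, Even (G.degree v)

/-- A graph is 2-edge-connected if it is connected and remains connected
after the deletion of any single edge. -/
def TwoEdgeConnected {n : ℕ} (G : SimpleGraph (Fin n)) : Prop :=
  G.Connected ∧ ∀ e ∈ G.edgeSet, (G.deleteEdges {e}).Connected

/-- A graph is 2-connected if it has at least 3 vertices and deleting any
single vertex leaves it connected (no cutvertex). -/
def TwoConnected {n : ℕ} (G : SimpleGraph (Fin n)) : Prop :=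
  3 ≤ n ∧ G.Connected ∧
    ∀ v : Fin n, ((⊤ : G.Subgraph).deleteVerts {v}).coe.Connected

/-- Every cut of the vertex set `A` is crossed by at least two edges of `G`. -/
def TwoEdgeConnectedOn {V : Type*} [DecidableEq V] (G : SimpleGraph V) (A : Finset V) : Prop :=
  ∀ S ⊆ A, S.Nonempty → (A \ S).Nonempty →
    ∃ x ∈ S, ∃ y ∈ A \ S, ∃ x' ∈ S, ∃ y' ∈ A \ S,
      G.Adj x y ∧ G.Adj x' y' ∧ ¬(x = x' ∧ y = y')

/-- No vertex of `A` is a cut vertex of the subgraph induced on `A`. -/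
def NoCutVertexOn {V : Type*} [DecidableEq V] (G : SimpleGraph V) (A : Finset V) : Prop :=
  ∀ c ∈ A, ∀ S ⊆ A.erase c, S.Nonempty → (A.erase c \ S).Nonempty →
    ∃ x ∈ S, ∃ y ∈ A.erase c \ S, G.Adj x y

section Numerics

lemma four_mul_sum_sub_odd_le (N n : ℕ) :
    4 * ∑ j ∈ range N, (n - (2 * j + 1)) ≤ n ^ 2 := by
  induction N generalizing n with
  | zero => simp
  | succ N ih =>
    rw [sum_range_succ']
    rcases n with _ | _ | n
    · simp
    · simp
    · have hs : ∑ j ∈ range N, (n + 1 + 1 - (2 * (j + 1) + 1)) =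
          ∑ j ∈ range N, (n - (2 * j + 1)) := sum_congr rfl fun j _ => by omega
      rw [hs]
      have := ih n
      simp only [mul_zero, zero_add, Nat.add_sub_cancel]
      nlinarith

lemma three_mul_sum_sub_le (N m : ℕ) :
    3 * ∑ j ∈ range N, (m - (3 * j + 1) / 2) ≤ m ^ 2 + m + if m % 3 = 1 then 1 else 0 := by
  induction N using Nat.twoStepInduction generalizing m with
  | zero => simp
  | one =>
    simp only [range_one, sum_singleton]
    rcases m with _ | _ | m
    · simp
    · simp
    · have : (m + 1 + 1) ^ 2 = m ^ 2 + 4 * m + 4 := by ring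
      omega
  | more N ih _ =>
    rw [sum_range_succ', sum_range_succ']
    rcases m with _ | _ | _ | m
    · simp
    · rw [sum_eq_zero fun j _ => by omega]; simp
    · rw [sum_eq_zero fun j _ => by omega]; simp
    · have hs : ∑ j ∈ range N, (m + 1 + 1 + 1 - (3 * (j + 1 + 1) + 1) / 2) =
          ∑ j ∈ range N, (m - (3 * j + 1) / 2) := sum_congr rfl fun j _ => by omega
      rw [hs]
      have := ih m
      have h3 : (m + 1 + 1 + 1) % 3 = m % 3 := by omega
      have hsq : (m + 1 + 1 + 1) ^ 2 = m ^ 2 + 6 * m + 9 := by ring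
      rw [h3]
      omega

lemma six_mul_sum_sub_le (N m : ℕ) (hm : 2 ≤ m) :
    6 * ∑ j ∈ range N, (m - (3 * j + 1) / 2) + 2 ≤ 2 * m ^ 2 + 3 * m := by
  have h := three_mul_sum_sub_le N m
  split_ifs at h with h1
  · have : 4 ≤ m := by omega
    omega
  · omega

lemma sq_div_four_le_sum_min (n : ℕ) : n ^ 2 / 4 ≤ ∑ k ∈ range n, min k (n - k) := by
  induction n using Nat.twoStepInduction with
  | zero => simp
  | one => simp
  | more n ih _ =>
    have hs : ∑ k ∈ range n, min (k + 1) (n + 2 - (k + 1)) =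
        ∑ k ∈ range n, (min k (n - k) + 1) :=
      sum_congr rfl fun k hk => by have := mem_range.mp hk; omega
    rw [sum_range_succ', sum_range_succ, hs, sum_add_distrib]
    have h2 : (n + 2) ^ 2 = n ^ 2 + 4 * (n + 1) := by ring
    rw [h2, Nat.add_mul_div_left _ _ (by norm_num)]
    simp
    omega

lemma glued_bound_lt {a b D₁ D₂ D s₁ s₂ : ℕ} (ha : 2 ≤ a) (hb : 2 ≤ b)
    (h₁ : D₁ ≤ (a + 1) * ((a + 1) ^ 2 / 4)) (h₂ : D₂ ≤ (b + 1) * ((b + 1) ^ 2 / 4))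
    (hs₁ : 6 * s₁ + 2 ≤ 2 * a ^ 2 + 3 * a) (hs₂ : 6 * s₂ + 2 ≤ 2 * b ^ 2 + 3 * b)
    (hD : D ≤ D₁ + D₂ + 2 * b * s₁ + 2 * a * s₂) :
    D < (a + b + 1) * ((a + b + 1) ^ 2 / 4) := by
  have h₁' : 4 * D₁ ≤ (a + 1) ^ 3 := by
    have := Nat.div_mul_le_self ((a + 1) ^ 2) 4
    nlinarith
  have h₂' : 4 * D₂ ≤ (b + 1) ^ 3 := by
    have := Nat.div_mul_le_self ((b + 1) ^ 2) 4
    nlinarith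
  have hq : (a + b + 1) ^ 2 ≤ 4 * ((a + b + 1) ^ 2 / 4) + 1 := by
    have hm : (a + b + 1) ^ 2 % 4 ≤ 1 := by
      rcases Nat.even_or_odd' (a + b + 1) with ⟨k, hk | hk⟩ <;> rw [hk]
      · rw [show (2 * k) ^ 2 = 4 * k ^ 2 by ring]; omega
      · rw [show (2 * k + 1) ^ 2 = 4 * (k ^ 2 + k) + 1 by ring]; omega
    omega
  have key : 4 * D + (a + b + 1) < (a + b + 1) ^ 3 := by
    have e₁ : 6 * (b * s₁) + 2 * b ≤ b * (2 * a ^ 2 + 3 * a) := by nlinarith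
    have e₂ : 6 * (a * s₂) + 2 * a ≤ a * (2 * b ^ 2 + 3 * b) := by nlinarith
    obtain ⟨p, rfl⟩ := Nat.exists_eq_add_of_le ha
    obtain ⟨q, rfl⟩ := Nat.exists_eq_add_of_le hb
    have hp := Nat.zero_le p
    have hpq : 0 ≤ p * q := Nat.zero_le _
    have hppq : 0 ≤ p * (p * q) := Nat.zero_le _
    have hpqq : 0 ≤ q * (p * q) := Nat.zero_le _
    have hpp : 0 ≤ p * p := Nat.zero_le _
    have hqq : 0 ≤ q * q := Nat.zero_le _
    nlinarith
  nlinarith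

end Numerics

section Layers

lemma SimpleGraph.Connected.dist_le_dist_add_one {V : Type*} {G : SimpleGraph V}
    (hG : G.Connected) {x y : V} (v : V)
    (h : G.Adj x y) : G.dist v y ≤ G.dist v x + 1 := by
  have := hG.dist_triangle (u := v) (v := x) (w := y)
  rwa [dist_eq_one_iff_adj.mpr h] at this

lemma card_near_add_card_far {V : Type*} (G : SimpleGraph V) (A : Finset V) (v : V) (j : ℕ) :
    #{x ∈ A | G.dist v x ≤ j} + #{x ∈ A | j < G.dist v x} = #A := by
  simpa using card_filter_add_card_filter_not (s := A) (fun x => G.dist v x ≤ j)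

lemma sum_dist_eq_sum_card_far {V : Type*} (G : SimpleGraph V) (A : Finset V) (v : V) :
    ∃ N, ∑ x ∈ A, G.dist v x = ∑ j ∈ range N, #{x ∈ A | j < G.dist v x} := by
  refine ⟨A.sup (G.dist v), ?_⟩
  simp_rw [card_filter]
  rw [sum_comm]
  refine sum_congr rfl fun x hx => ?_
  have hle : G.dist v x ≤ A.sup (G.dist v) := le_sup (f := G.dist v) hx
  rw [← card_filter]
  have : {j ∈ range (A.sup (G.dist v)) | j < G.dist v x} = range (G.dist v x) := by
    ext j
    simp only [mem_filter, mem_range]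
    omega
  rw [this, card_range]

variable {V : Type*} [DecidableEq V] {G : SimpleGraph V} {A : Finset V}

/-- Two distinct edges leave each ball that does not cover `A`. -/
lemma TwoEdgeConnectedOn.exists_layer_edges (hA : TwoEdgeConnectedOn G A) (hG : G.Connected)
    {v : V} (hv : v ∈ A) {j : ℕ} (hj : {x ∈ A | j < G.dist v x}.Nonempty) :
    ∃ x ∈ A, ∃ y ∈ A, ∃ x' ∈ A, ∃ y' ∈ A, ¬(x = x' ∧ y = y') ∧ G.Adj x y ∧ G.Adj x' y' ∧
      G.dist v x = j ∧ G.dist v y = j + 1 ∧ G.dist v x' = j ∧ G.dist v y' = j + 1 := by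
  obtain ⟨z, hz⟩ := hj
  obtain ⟨x, hx, y, hy, x', hx', y', hy', h, h', hne⟩ :=
    hA {x ∈ A | G.dist v x ≤ j} (filter_subset _ _) ⟨v, by simp [hv]⟩
      ⟨z, by simp at hz ⊢; exact ⟨hz.1, fun _ => hz.2⟩⟩
  have l := hG.dist_le_dist_add_one v h
  have l' := hG.dist_le_dist_add_one v h'
  simp only [mem_filter, mem_sdiff, not_and, not_le] at hx hy hx' hy'
  have := hy.2 hy.1
  have := hy'.2 hy'.1
  exact ⟨x, hx.1, y, hy.1, x', hx'.1, y', hy'.1, hne, h, h', by omega, by omega, by omega,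
    by omega⟩

lemma TwoEdgeConnectedOn.card_near_add_three_le (hA : TwoEdgeConnectedOn G A)
    (hG : G.Connected) {v : V} (hv : v ∈ A) {j : ℕ}
    (hj : {x ∈ A | j + 1 < G.dist v x}.Nonempty) :
    #{x ∈ A | G.dist v x ≤ j} + 3 ≤ #{x ∈ A | G.dist v x ≤ j + 2} := by
  obtain ⟨x, hx, y, hy, x', hx', y', hy', hne, -, -, dx, dy, dx', dy'⟩ :=
    hA.exists_layer_edges hG hv hj
  have hxy : x ≠ y := by rintro rfl; omega
  have hxy' : x' ≠ y := by rintro rfl; omega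
  have hyx : x ≠ y' := by rintro rfl; omega
  obtain ⟨T, hT, hcard⟩ : ∃ T ⊆ {z ∈ A | j < G.dist v z ∧ G.dist v z ≤ j + 2}, #T = 3 := by
    by_cases hxx : x = x'
    · have hyy : y ≠ y' := fun h => hne ⟨hxx, h⟩
      refine ⟨{x, y, y'}, ?_, card_eq_three.mpr ⟨x, y, y', hxy, hyx, hyy, rfl⟩⟩
      intro z hz
      simp only [mem_insert, mem_singleton] at hz
      rcases hz with rfl | rfl | rfl <;> simp [*]
    · refine ⟨{x, x', y}, ?_, card_eq_three.mpr ⟨x, x', y, hxx, hxy, hxy', rfl⟩⟩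
      intro z hz
      simp only [mem_insert, mem_singleton] at hz
      rcases hz with rfl | rfl | rfl <;> simp [*]
  rw [← hcard, ← card_union_of_disjoint]
  · refine card_le_card (union_subset ?_ (hT.trans ?_))
    · intro z; grind
    · intro z; grind
  · rw [Finset.disjoint_left]
    intro z hz hzT
    have := hT hzT
    simp at hz this
    omega

lemma TwoEdgeConnectedOn.exists_two_neighbors (hA : TwoEdgeConnectedOn G A) {v : V}
    (hv : v ∈ A) (h1 : 1 < #A) :
    ∃ y ∈ A, ∃ y' ∈ A, y ≠ y' ∧ G.Adj v y ∧ G.Adj v y' := by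
  obtain ⟨w, hw, hne⟩ := exists_mem_ne h1 v
  obtain ⟨x, hx, y, hy, x', hx', y', hy', h, h', hn⟩ :=
    hA {v} (by simpa using hv) ⟨v, by simp⟩ ⟨w, by simp [hw, hne]⟩
  simp only [mem_singleton] at hx hx'
  subst hx hx'
  exact ⟨y, (mem_sdiff.mp hy).1, y', (mem_sdiff.mp hy').1, fun e => hn ⟨rfl, e⟩, h, h'⟩

lemma TwoEdgeConnectedOn.three_le_card (hA : TwoEdgeConnectedOn G A) (h1 : 1 < #A) :
    3 ≤ #A := by
  obtain ⟨v, hv⟩ := card_pos.mp (by omega : 0 < #A)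
  obtain ⟨y, hy, y', hy', hne, h, h'⟩ := hA.exists_two_neighbors hv h1
  rw [← card_eq_three.mpr ⟨v, y, y', h.ne, h'.ne, hne, rfl⟩]
  refine card_le_card ?_
  simp [insert_subset_iff, *]

lemma TwoEdgeConnectedOn.le_card_near (hA : TwoEdgeConnectedOn G A) (hG : G.Connected)
    {v : V} (hv : v ∈ A) (j : ℕ) (hj : {x ∈ A | j < G.dist v x}.Nonempty) :
    (3 * j + 1) / 2 + 1 ≤ #{x ∈ A | G.dist v x ≤ j} := by
  induction j using Nat.twoStepInduction with
  | zero => exact card_pos.mpr ⟨v, by simp [hv]⟩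
  | one =>
    obtain ⟨z, hz⟩ := hj
    simp only [mem_filter] at hz
    have hvz : v ≠ z := by rintro rfl; simp at hz
    obtain ⟨y, hy, y', hy', hne, h, h'⟩ :=
      hA.exists_two_neighbors hv (one_lt_card.mpr ⟨v, hv, z, hz.1, hvz⟩)
    rw [show (3 * 1 + 1) / 2 + 1 = 3 by rfl,
      ← card_eq_three.mpr ⟨v, y, y', h.ne, h'.ne, hne, rfl⟩]
    refine card_le_card ?_
    simp [insert_subset_iff, *, dist_eq_one_iff_adj.mpr h, dist_eq_one_iff_adj.mpr h']
  | more j ih _ =>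
    have mono : ∀ i ≤ j + 2, {x ∈ A | i < G.dist v x}.Nonempty := fun i hi =>
      hj.mono fun z => by grind
    have h1 := ih (mono j (by omega))
    have h2 := hA.card_near_add_three_le hG hv (mono (j + 1) (by omega))
    omega

lemma TwoEdgeConnectedOn.card_near_add_two_le (hA : TwoEdgeConnectedOn G A)
    (hC : NoCutVertexOn G A) (hG : G.Connected) {v : V} (hv : v ∈ A) {j : ℕ}
    (hj : {x ∈ A | j + 1 < G.dist v x}.Nonempty) :
    #{x ∈ A | G.dist v x ≤ j} + 2 ≤ #{x ∈ A | G.dist v x ≤ j + 1} := by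
  obtain ⟨-, -, c, hc, -, -, -, -, -, -, -, -, dc, -⟩ :=
    hA.exists_layer_edges hG hv (j := j) (hj.mono fun z => by grind)
  obtain ⟨z, hz⟩ := hj
  simp only [mem_filter] at hz
  obtain ⟨c', hc', dc', hne⟩ : ∃ c' ∈ A, G.dist v c' = j + 1 ∧ c ≠ c' := by
    by_contra! hcon
    obtain ⟨x, hx, y, hy, h⟩ := hC c hc {x ∈ A | G.dist v x ≤ j}
      (fun x hx => by
        simp only [mem_filter, mem_erase] at hx ⊢
        exact ⟨by rintro rfl; omega, hx.1⟩)
      ⟨v, by simp [hv]⟩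
      ⟨z, by
        simp only [mem_filter, mem_erase, mem_sdiff, not_and, not_le]
        exact ⟨⟨by rintro rfl; omega, hz.1⟩, fun _ => by omega⟩⟩
    have l := hG.dist_le_dist_add_one v h
    simp only [mem_filter, mem_erase, mem_sdiff, not_and, not_le] at hx hy
    have := hy.2 hy.1.2
    exact hy.1.1 (hcon y hy.1.2 (by omega)).symm
  rw [← card_pair hne, ← card_union_of_disjoint]
  · refine card_le_card (union_subset ?_ ?_)
    · intro z; grind
    · simp [insert_subset_iff, *]
  · rw [Finset.disjoint_left]
    intro z hz hzT
    simp only [mem_filter, mem_insert, mem_singleton] at hz hzT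
    rcases hzT with rfl | rfl <;> omega

lemma TwoEdgeConnectedOn.odd_le_card_near (hA : TwoEdgeConnectedOn G A)
    (hC : NoCutVertexOn G A) (hG : G.Connected) {v : V} (hv : v ∈ A) (j : ℕ)
    (hj : {x ∈ A | j < G.dist v x}.Nonempty) :
    2 * j + 1 ≤ #{x ∈ A | G.dist v x ≤ j} := by
  induction j with
  | zero => exact card_pos.mpr ⟨v, by simp [hv]⟩
  | succ j ih =>
    have h1 := ih (hj.mono fun z => by grind)
    have h2 := hA.card_near_add_two_le hC hG hv hj
    omega

lemma TwoEdgeConnectedOn.card_far_le (hA : TwoEdgeConnectedOn G A)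
    (hC : NoCutVertexOn G A) (hG : G.Connected) {v : V} (hv : v ∈ A) (j : ℕ) :
    #{x ∈ A | j < G.dist v x} ≤ #A - (2 * j + 1) := by
  rcases eq_empty_or_nonempty {x ∈ A | j < G.dist v x} with h | h
  · simp [h]
  · have := hA.odd_le_card_near hC hG hv j h
    have := card_near_add_card_far G A v j
    omega

/-- Bound on the transmission of a vertex. -/
lemma TwoEdgeConnectedOn.six_mul_sum_dist_le (hA : TwoEdgeConnectedOn G A) (hG : G.Connected)
    {v : V} (hv : v ∈ A) {m : ℕ} (hm : 2 ≤ m) (hcard : #A = m + 1) :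
    6 * ∑ x ∈ A, G.dist v x + 2 ≤ 2 * m ^ 2 + 3 * m := by
  obtain ⟨N, hN⟩ := sum_dist_eq_sum_card_far G A v
  have hle : ∑ x ∈ A, G.dist v x ≤ ∑ j ∈ range N, (m - (3 * j + 1) / 2) := by
    rw [hN]
    refine sum_le_sum fun j _ => ?_
    rcases eq_empty_or_nonempty {x ∈ A | j < G.dist v x} with h | h
    · simp [h]
    · have := hA.le_card_near hG hv j h
      have := card_near_add_card_far G A v j
      omega
  have := six_mul_sum_sub_le N m hm
  omega

lemma TwoEdgeConnectedOn.sum_dist_le (hA : TwoEdgeConnectedOn G A)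
    (hC : NoCutVertexOn G A) (hG : G.Connected) {v : V} (hv : v ∈ A) :
    ∑ x ∈ A, G.dist v x ≤ #A ^ 2 / 4 := by
  obtain ⟨N, hN⟩ := sum_dist_eq_sum_card_far G A v
  have hle := hN.trans_le (sum_le_sum fun j _ => hA.card_far_le hC hG hv j)
  have := four_mul_sum_sub_odd_le N #A
  omega

lemma TwoEdgeConnectedOn.sum_dist_lt [DecidableRel G.Adj] (hA : TwoEdgeConnectedOn G A)
    (hC : NoCutVertexOn G A) (hG : G.Connected) {v : V} (hv : v ∈ A)
    (hdeg : 2 < #{x ∈ A | G.Adj v x}) :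
    ∑ x ∈ A, G.dist v x < #A ^ 2 / 4 := by
  have hfar : #{x ∈ A | 1 < G.dist v x} + 4 ≤ #A := by
    have h1 := card_near_add_card_far G A v 1
    have h2 : insert v {x ∈ A | G.Adj v x} ⊆ {x ∈ A | G.dist v x ≤ 1} := by
      intro z hz
      simp only [mem_insert, mem_filter] at hz ⊢
      rcases hz with rfl | hz
      · simp [hv]
      · exact ⟨hz.1, (dist_eq_one_iff_adj.mpr hz.2).le⟩
    have h3 := card_le_card h2
    rw [card_insert_of_notMem (by simp)] at h3
    omega
  obtain ⟨N, hN⟩ := sum_dist_eq_sum_card_far G A v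
  have hle : ∑ x ∈ A, G.dist v x ≤ ∑ j ∈ range (N + 2), #{x ∈ A | j < G.dist v x} :=
    hN.trans_le (sum_le_sum_of_subset (range_mono (by omega)))
  have hlt : ∑ j ∈ range (N + 2), #{x ∈ A | j < G.dist v x} <
      ∑ j ∈ range (N + 2), (#A - (2 * j + 1)) :=
    sum_lt_sum (fun j _ => hA.card_far_le hC hG hv j) ⟨1, by simp, by omega⟩
  have := four_mul_sum_sub_odd_le (N + 2) #A
  omega

end Layers

section Gluing

variable {V : Type*} [DecidableEq V] {G : SimpleGraph V} {A : Finset V}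

lemma TwoEdgeConnectedOn.of_forall_notMem {c : V}
    (h : ∀ S ⊆ A, c ∉ S → S.Nonempty → ∃ x ∈ S, ∃ y ∈ A \ S, ∃ x' ∈ S, ∃ y' ∈ A \ S,
      G.Adj x y ∧ G.Adj x' y' ∧ ¬(x = x' ∧ y = y')) : TwoEdgeConnectedOn G A := by
  intro S hS hne hne'
  by_cases hc : c ∈ S
  · obtain ⟨x, hx, y, hy, x', hx', y', hy', e, e', hn⟩ :=
      h (A \ S) sdiff_subset (by simp [hc]) hne'
    rw [Finset.sdiff_sdiff_eq_self hS] at hy hy'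
    exact ⟨y, hy, x, hx, y', hy', x', hx', e.symm, e'.symm, fun k => hn ⟨k.2, k.1⟩⟩
  · exact h S hS hc hne

/-- A union of components of `A` minus a cut vertex, together with the cut vertex, inherits
two-edge-connectedness. -/
lemma TwoEdgeConnectedOn.insert_of_no_edges (hA : TwoEdgeConnectedOn G A) {c : V} (hc : c ∈ A)
    {S : Finset V} (hS : S ⊆ A.erase c)
    (hno : ∀ x ∈ S, ∀ y ∈ A.erase c \ S, ¬ G.Adj x y) : TwoEdgeConnectedOn G (insert c S) := by
  refine .of_forall_notMem (c := c) fun T hT hcT hne => ?_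
  have hTS : T ⊆ S := fun x hx => (mem_insert.mp (hT hx)).resolve_left (by rintro rfl; exact hcT hx)
  obtain ⟨x, hx, y, hy, x', hx', y', hy', e, e', hn⟩ :=
    hA T (hTS.trans (hS.trans (erase_subset _ _))) hne ⟨c, by simp [hc, hcT]⟩
  have aux : ∀ x ∈ T, ∀ y ∈ A \ T, G.Adj x y → y ∈ insert c S \ T := by
    intro x hx y hy e
    have := hno x (hTS hx) y
    simp only [mem_sdiff, mem_insert, mem_erase] at *
    tauto
  exact ⟨x, hx, y, aux x hx y hy e, x', hx', y', aux x' hx' y' hy' e', e, e', hn⟩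

lemma sum_sum_dist_union_le (hG : G.Connected) {S T : Finset V} {c : V} (hcS : c ∉ S)
    (hST : Disjoint S T) :
    ∑ x ∈ S ∪ T, ∑ y ∈ S ∪ T, G.dist x y + 2 * ∑ x ∈ insert c S, G.dist c x ≤
      ∑ x ∈ insert c S, ∑ y ∈ insert c S, G.dist x y + ∑ x ∈ T, ∑ y ∈ T, G.dist x y +
        2 * #T * ∑ x ∈ insert c S, G.dist c x + 2 * #S * ∑ x ∈ T, G.dist c x := by
  have hcross : ∑ x ∈ S, ∑ y ∈ T, G.dist x y ≤
      #T * ∑ x ∈ S, G.dist c x + #S * ∑ y ∈ T, G.dist c y := by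
    calc ∑ x ∈ S, ∑ y ∈ T, G.dist x y
        ≤ ∑ x ∈ S, ∑ y ∈ T, (G.dist c x + G.dist c y) :=
          sum_le_sum fun x _ => sum_le_sum fun y _ => by
            rw [dist_comm (u := c) (v := x)]; exact hG.dist_triangle
      _ = _ := by simp [sum_add_distrib, mul_sum]
  have hsymm : ∑ x ∈ T, ∑ y ∈ S, G.dist x y = ∑ x ∈ S, ∑ y ∈ T, G.dist x y := by
    rw [sum_comm]; simp_rw [dist_comm]
  have hsymm' : ∑ x ∈ S, G.dist x c = ∑ x ∈ S, G.dist c x := by simp_rw [dist_comm]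
  simp only [sum_union hST, sum_insert hcS, sum_add_distrib, dist_self, hsymm, hsymm']
  nlinarith

theorem TwoEdgeConnectedOn.sum_sum_dist_le [DecidableRel G.Adj] (hG : G.Connected)
    (hA : TwoEdgeConnectedOn G A) :
    ∑ x ∈ A, ∑ y ∈ A, G.dist x y ≤ #A * (#A ^ 2 / 4) ∧
      (∑ x ∈ A, ∑ y ∈ A, G.dist x y = #A * (#A ^ 2 / 4) →
        ∀ v ∈ A, #{x ∈ A | G.Adj v x} ≤ 2) := by
  induction hn : #A using Nat.strong_induction_on generalizing A with
  | _ n ih =>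
  subst hn
  by_cases hC : NoCutVertexOn G A
  · have hle : ∀ x ∈ A, ∑ y ∈ A, G.dist x y ≤ #A ^ 2 / 4 := fun x hx => hA.sum_dist_le hC hG hx
    have hconst : ∑ _x ∈ A, #A ^ 2 / 4 = #A * (#A ^ 2 / 4) := by simp
    refine ⟨hconst ▸ sum_le_sum hle, fun heq v hv => ?_⟩
    by_contra! hdeg
    have := sum_lt_sum hle ⟨v, hv, hA.sum_dist_lt hC hG hv hdeg⟩
    omega
  · suffices ∑ x ∈ A, ∑ y ∈ A, G.dist x y < #A * (#A ^ 2 / 4) from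
      ⟨this.le, fun h => absurd h this.ne⟩
    simp only [NoCutVertexOn] at hC
    push Not at hC
    obtain ⟨c, hc, S, hS, hSne, hSne', hno⟩ := hC
    have hcS : c ∉ S := fun h => by simpa using hS h
    have hSA : S ⊆ A := hS.trans (erase_subset _ _)
    have hT : A \ S = insert c (A.erase c \ S) := by
      ext x; by_cases hx : x = c <;> simp [hx, hc, hcS]
    have hA₁ : TwoEdgeConnectedOn G (insert c S) := hA.insert_of_no_edges hc hS hno
    have hA₂ : TwoEdgeConnectedOn G (A \ S) := by
      rw [hT]
      refine hA.insert_of_no_edges hc sdiff_subset fun x hx y hy e => ?_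
      rw [Finset.sdiff_sdiff_eq_self hS] at hy
      exact hno y hy x hx e.symm
    have hcard₁ : #(insert c S) = #S + 1 := card_insert_of_notMem hcS
    have hcard₂ : #(A \ S) = #(A.erase c \ S) + 1 := by
      rw [hT, card_insert_of_notMem (by simp)]
    have hcardA : #(A \ S) + #S = #A := card_sdiff_add_card_eq_card hSA
    have hpos₁ := hSne.card_pos
    have hpos₂ := hSne'.card_pos
    have ha : 2 ≤ #S := by have := hA₁.three_le_card (by omega); omega
    have hb : 2 ≤ #(A.erase c \ S) := by have := hA₂.three_le_card (by omega); omega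
    have hD₁ := (ih _ (by omega) hA₁ rfl).1
    have hD₂ := (ih _ (by omega) hA₂ rfl).1
    have hs₁ := hA₁.six_mul_sum_dist_le hG (mem_insert_self c S) ha hcard₁
    have hs₂ := hA₂.six_mul_sum_dist_le hG (by simp [hc, hcS] : c ∈ A \ S) hb hcard₂
    have hD := sum_sum_dist_union_le hG hcS (disjoint_sdiff (s := S) (t := A))
    rw [union_sdiff_of_subset hSA] at hD
    rw [hcard₁] at hD₁
    rw [hcard₂] at hD₂ hD
    have hA' : #A = #S + #(A.erase c \ S) + 1 := by omega
    rw [hA']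
    refine glued_bound_lt ha hb hD₁ hD₂ hs₁ hs₂ ?_
    nlinarith

end Gluing

section Cycle

lemma min_val_sub_le_dist_cycleGraph {n : ℕ} (u v : Fin n) :
    min (u - v).val (v - u).val ≤ (cycleGraph n).dist u v := by
  obtain ⟨p, hp⟩ := (cycleGraph_preconnected u v).exists_walk_length_eq_dist
  rw [← hp]
  clear hp
  induction p with
  | nil => simp [Fin.sub_def, Nat.sub_add_cancel (Fin.isLt _).le]
  | @cons a b d h p ih =>
    rw [Walk.length_cons]
    rw [cycleGraph_adj'] at h
    simp only [Fin.sub_def] at h ih ⊢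
    have ha := a.isLt
    have hb := b.isLt
    have hd := d.isLt
    have key : ∀ x y : ℕ, x < n → y < n →
        (n - y + x) % n = if y ≤ x then x - y else n + x - y := by
      intro x y hx hy
      split_ifs with hxy
      · rw [show n - y + x = (x - y) + n by omega, Nat.add_mod_right, Nat.mod_eq_of_lt (by omega)]
      · rw [Nat.mod_eq_of_lt (by omega)]; omega
    rw [key _ _ ha hb, key _ _ hb ha] at h
    rw [key _ _ hb hd, key _ _ hd hb] at ih
    rw [key _ _ ha hd, key _ _ hd ha]
    split_ifs at * <;> omega

lemma card_mul_le_sum_sum_dist_cycleGraph (n : ℕ) :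
    n * (n ^ 2 / 4) ≤ ∑ u, ∑ v, (cycleGraph n).dist u v := by
  have hu : ∀ u : Fin n, n ^ 2 / 4 ≤ ∑ v, (cycleGraph n).dist u v := by
    intro u
    have : NeZero n := ⟨by have := u.isLt; omega⟩
    calc n ^ 2 / 4 ≤ ∑ k ∈ range n, min k (n - k) := sq_div_four_le_sum_min n
      _ = ∑ k : Fin n, min k.val (n - k.val) :=
        (Fin.sum_univ_eq_sum_range (fun k => min k (n - k)) n).symm
      _ = ∑ v : Fin n, min (v - u).val (n - (v - u).val) :=
        (Equiv.sum_comp (Equiv.subRight u) fun k : Fin n => min k.val (n - k.val)).symm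
      _ ≤ ∑ v, (cycleGraph n).dist u v := sum_le_sum fun v _ => by
        refine le_trans ?_ (min_val_sub_le_dist_cycleGraph u v)
        simp only [Fin.sub_def]
        have hu := u.isLt
        have hv := v.isLt
        rcases lt_trichotomy u.val v.val with h | h | h
        · rw [show n - u.val + v.val = (v - u) + n by omega, Nat.add_mod_right,
            Nat.mod_eq_of_lt (by omega), Nat.mod_eq_of_lt (by omega)]
          omega
        · rw [h, Nat.sub_add_cancel hv.le]; simp
        · rw [show n - v.val + u.val = (u - v) + n by omega, Nat.add_mod_right,
            Nat.mod_eq_of_lt (by omega), Nat.mod_eq_of_lt (by omega)]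
          omega
  simpa using sum_le_sum fun u (_ : u ∈ univ) => hu u

/-- A finite connected graph all of whose vertices have exactly two neighbours is a cycle. -/
lemma nonempty_iso_cycleGraph {n : ℕ} {G : SimpleGraph (Fin n)} (hG : G.Connected)
    (hdeg : ∀ v, (G.neighborSet v).ncard = 2) : Nonempty (G ≃g cycleGraph n) := by
  classical
  obtain ⟨v⟩ := hG.nonempty
  obtain ⟨p, hp, hverts⟩ :=
    IsCycles.exists_cycle_toSubgraph_verts_eq_connectedComponentSupp (v := v)
      (c := G.connectedComponentMk v) (fun v _ => hdeg v) rfl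
      (Set.nonempty_of_ncard_ne_zero (by rw [hdeg]; norm_num))
  have hmem : ∀ w, w ∈ p.support := by
    intro w
    rw [← Walk.mem_verts_toSubgraph, hverts]
    exact ConnectedComponent.sound (hG.preconnected w v)
  have hham : p.IsHamiltonianCycle := by
    rw [Walk.isHamiltonianCycle_iff_isCycle_and_support_count_tail_eq_one]
    refine ⟨hp, fun w => List.count_eq_one_of_mem hp.support_nodup ?_⟩
    rcases (Walk.mem_support_iff p).mp (hmem w) with rfl | h
    · exact Walk.end_mem_tail_support hp.not_nil
    · exact h
  have hlen : p.length = n := by simpa using hham.length_eq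
  have hn : 2 < n := by have := hp.three_le_length; omega
  obtain ⟨f⟩ := (cycleGraph_isContained_iff hn).mpr ⟨v, p, hp, hlen⟩
  have hbij : Function.Bijective f := Finite.injective_iff_bijective.mp f.injective
  have himage : ∀ a, f '' (cycleGraph n).neighborSet a = G.neighborSet (f a) := by
    intro a
    refine Set.eq_of_subset_of_ncard_le ?_ ?_
    · rintro _ ⟨b, hb, rfl⟩
      exact f.toHom.map_adj hb
    · rw [hdeg, Set.ncard_image_of_injective ((cycleGraph n).neighborSet a) (f := f) f.injective]
      obtain ⟨k, rfl⟩ : ∃ k, n = k + 3 := ⟨n - 3, by omega⟩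
      rw [Set.ncard_eq_toFinset_card', ← neighborFinset, card_neighborFinset_eq_degree,
        cycleGraph_degree_three_le]
  refine ⟨(RelIso.symm ⟨Equiv.ofBijective f hbij, ?_⟩)⟩
  intro a b
  refine ⟨fun h => ?_, fun h => f.toHom.map_adj h⟩
  have : f b ∈ f '' (cycleGraph n).neighborSet a := by rw [himage]; exact h
  exact (f.injective.mem_set_image).mp this

end Cycle

lemma two_mul_wienerIndex {n : ℕ} (G : SimpleGraph (Fin n)) :
    2 * wienerIndex G = ∑ u, ∑ v, G.dist u v := by
  have hswap : ∑ p : Fin n × Fin n with p.2 < p.1, G.dist p.1 p.2 = wienerIndex G := by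
    refine sum_equiv (Equiv.prodComm _ _) (by simp) fun p _ => ?_
    simp [dist_comm]
  have hnot : ∑ p : Fin n × Fin n with ¬ p.1 < p.2, G.dist p.1 p.2 =
      ∑ p : Fin n × Fin n with p.2 < p.1, G.dist p.1 p.2 := by
    symm
    refine sum_subset (fun p => by simp; exact le_of_lt) fun p h₁ h₂ => ?_
    simp only [mem_filter, mem_univ, true_and, not_lt] at h₁ h₂
    rw [le_antisymm h₁ h₂, dist_self]
  rw [← Fintype.sum_prod_type' (f := fun u v => G.dist u v),
    ← sum_filter_add_sum_filter_not univ (fun p : Fin n × Fin n => p.1 < p.2), hnot, hswap, two_mul]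
  rfl

lemma SimpleGraph.Iso.dist_le {V W : Type*} {G : SimpleGraph V} {H : SimpleGraph W}
    (f : G ≃g H) (hG : G.Connected) (u v : V) : H.dist (f u) (f v) ≤ G.dist u v := by
  obtain ⟨p, hp⟩ := hG.exists_walk_length_eq_dist u v
  rw [← hp, ← Walk.length_map f.toHom p]
  exact SimpleGraph.dist_le _

lemma wienerIndex_le_of_iso {n : ℕ} {G H : SimpleGraph (Fin n)} (f : G ≃g H)
    (hG : G.Connected) : wienerIndex H ≤ wienerIndex G := by
  have h : ∑ u, ∑ v, H.dist u v ≤ ∑ u, ∑ v, G.dist u v := by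
    rw [← Equiv.sum_comp f.toEquiv]
    refine sum_le_sum fun u _ => ?_
    rw [← Equiv.sum_comp f.toEquiv]
    exact sum_le_sum fun v _ => f.dist_le hG u v
  rw [← two_mul_wienerIndex, ← two_mul_wienerIndex] at h
  omega

lemma TwoEdgeConnected.twoEdgeConnectedOn_univ {n : ℕ} {G : SimpleGraph (Fin n)}
    (h : TwoEdgeConnected G) : TwoEdgeConnectedOn G univ := by
  rintro S - ⟨u, hu⟩ ⟨w, hw⟩
  have hw' : w ∉ (S : Set (Fin n)) := by simpa using hw
  have hu' : u ∈ (S : Set (Fin n)) := hu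
  obtain ⟨p⟩ := h.1.preconnected u w
  obtain ⟨d, -, hd, hd'⟩ := p.exists_boundary_dart S hu' hw'
  obtain ⟨q⟩ := (h.2 s(d.fst, d.snd) d.adj).preconnected u w
  obtain ⟨e, -, he, he'⟩ := q.exists_boundary_dart S hu' hw'
  have hadj := e.adj
  rw [deleteEdges_adj] at hadj
  refine ⟨d.fst, hd, d.snd, by simpa using hd', e.fst, he, e.snd, by simpa using he', d.adj,
    hadj.1, fun k => hadj.2 ?_⟩
  simp [k.1, k.2]

/-- For every 2-edge-connected graph `G` of order `n`, `W(G) ≤ W(C_n)`,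
with equality if and only if `G ≅ C_n`. -/
theorem wiener_le_of_twoEdgeConnected {n : ℕ} (G : SimpleGraph (Fin n))
    (h : TwoEdgeConnected G) :
    wienerIndex G ≤ wienerIndex (cycleGraph n) ∧
      (wienerIndex G = wienerIndex (cycleGraph n) ↔
        Nonempty (G ≃g cycleGraph n)) := by
  classical
  have hA := h.twoEdgeConnectedOn_univ
  obtain ⟨hle, hdeg⟩ := hA.sum_sum_dist_le h.1
  have hge := card_mul_le_sum_sum_dist_cycleGraph n
  rw [card_univ, Fintype.card_fin, ← two_mul_wienerIndex] at hle hdeg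
  rw [← two_mul_wienerIndex] at hge
  have hW : wienerIndex G ≤ wienerIndex (cycleGraph n) := by omega
  refine ⟨hW, fun heq => ?_, fun ⟨f⟩ => hW.antisymm (wienerIndex_le_of_iso f h.1)⟩
  rcases Nat.lt_or_ge 1 n with hn | hn
  · refine nonempty_iso_cycleGraph h.1 fun v => le_antisymm ?_ ?_
    · have := hdeg (by omega) v (mem_univ v)
      rwa [← Set.ncard_coe_finset, coe_filter_univ] at this
    · obtain ⟨y, -, y', -, hne, e, e'⟩ := hA.exists_two_neighbors (mem_univ v) (by simpa using hn)
      rw [← Set.ncard_pair hne]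
      exact Set.ncard_le_ncard (by rintro z (rfl | rfl) <;> assumption)
  · have : Subsingleton (Fin n) := Fin.subsingleton_iff_le_one.mpr hn
    rw [Subsingleton.elim G (cycleGraph n)]
    exact ⟨Iso.refl⟩
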